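/- Let ⟨A, C, d, O, v, (≺_a)_{a∈A}⟩ be an infinite sequential game and let Γ be a collection of subsets of C^ω. Assume: (1) each ≺_a is a strict weak order; (2) every two-player win/lose game ⟨C, D, W⟩ with D ⊆ C* and W ∈ Γ is determined; (3) for every player a, every ≺_a-terminal interval I, and every γ ∈ C*, v^{-1}(I) ∩ γC^ω ∈ Γ; (4) for every player a, every play p ∈ C^ω, and every strictly increasing φ : ℕ → ℕ, if d(p_{<φ(n)}) = a and G_a(p_{<φ(n+1)}) ⊊ G_a(p_{<φ(n)}) for all n ∈ ℕ, then v(p) ∈ ∩_{n∈ℕ} G_a(p_{<φ(n)}); (5) for every player a and every γ ∈ C* there exists a strategy s of a with g_a(γ,s) = G_a(γ). Then the game has a Nash equilibrium. -/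

import Mathlib

namespace SeqGame

variable {A C O : Type*}

/-- The length-`n` prefix of an infinite sequence, as a list. -/
def pre (p : ℕ → C) (n : ℕ) : List C := List.ofFn (fun i : Fin n => p i)

/-- The length-`n` history of the play induced by the strategy profile `σ` starting at `γ`. -/
def hist (σ : List C → C) (γ : List C) : ℕ → List C
  | 0 => []
  | n + 1 => hist σ γ n ++
      [if h : n < γ.length then γ.get ⟨n, h⟩ else σ (hist σ γ n)]

/-- The play `p^γ(σ)` induced by the strategy profile `σ` starting at `γ`. -/
def play (σ : List C → C) (γ : List C) (n : ℕ) : C :=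
  if h : n < γ.length then γ.get ⟨n, h⟩ else σ (hist σ γ n)

/-- `σ'` is an `a`-deviation of the strategy profile `σ`. -/
def Dev (d : List C → A) (a : A) (σ σ' : List C → C) : Prop :=
  ∀ h : List C, d h ≠ a → σ' h = σ h

/-- `r` is a strict weak order: irreflexive, transitive, with transitive incomparability. -/
def SWO (r : O → O → Prop) : Prop :=
  (∀ x, ¬ r x x) ∧ (∀ x y z, r x y → r y z → r x z) ∧
  (∀ x y z, ¬ r x y → ¬ r y z → ¬ r x z)

/-- `r` is a strict linear order: irreflexive, transitive and total. -/
def SLO (r : O → O → Prop) : Prop :=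
  (∀ x, ¬ r x x) ∧ (∀ x y z, r x y → r y z → r x z) ∧
  (∀ x y, x = y ∨ r x y ∨ r y x)

/-- The play `p` is consistent with the strategy `s` of player `a` from `γ` on. -/
def Consistent (d : List C → A) (a : A) (s : List C → C) (γ : List C) (p : ℕ → C) : Prop :=
  pre p γ.length = γ ∧ ∀ n, γ.length ≤ n → d (pre p n) = a → p n = s (pre p n)

/-- The guarantee `g_a(γ, s)` of player `a` (with preference `r`) by strategy `s` at `γ`. -/
def gua (d : List C → A) (v : (ℕ → C) → O) (r : O → O → Prop) (a : A)
    (γ : List C) (s : List C → C) : Set O :=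
  {o | ∃ p : ℕ → C, Consistent d a s γ p ∧ ¬ r o (v p)}

/-- The best guarantee `G_a(γ)` of player `a` (with preference `r`) at `γ`. -/
def Gua (d : List C → A) (v : (ℕ → C) → O) (r : O → O → Prop) (a : A) (γ : List C) : Set O :=
  ⋂ s : List C → C, gua d v r a γ s

/-- `I` is a `r`-terminal interval: `o ∈ I` and `¬(o' ≺ o)` imply `o' ∈ I`. -/
def Terminal (r : O → O → Prop) (I : Set O) : Prop :=
  ∀ o ∈ I, ∀ o', ¬ r o' o → o' ∈ I

/-- `I` is a `r`-extremal interval. -/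
def Extremal (r : O → O → Prop) (I : Set O) : Prop :=
  Terminal r I ∨ Terminal (fun x y => r y x) I

/-- `γ C^ω`: the set of plays extending the finite sequence `γ`. -/
def ext (γ : List C) : Set (ℕ → C) := {p | pre p γ.length = γ}

/-- Concatenation `γ·α` of a finite sequence and an infinite one. -/
def cat (γ : List C) (α : ℕ → C) : ℕ → C :=
  fun n => if h : n < γ.length then γ.get ⟨n, h⟩ else α (n - γ.length)

/-- The two-player win/lose game `⟨C, D, W⟩` is determined. -/
def Determined (D : Set (List C)) (W : Set (ℕ → C)) : Prop :=
  (∃ s : List C → C, ∀ p : ℕ → C, (∀ n, pre p n ∈ D → p n = s (pre p n)) → p ∈ W) ∨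
  (∃ t : List C → C, ∀ p : ℕ → C, (∀ n, pre p n ∉ D → p n = t (pre p n)) → p ∉ W)

/-- In a two-player game (`true` is player `a`, `false` is player `b`) with antagonistic
preferences, the preference of each player derived from the preference `r` of player `a`. -/
def rel (r : O → O → Prop) : Bool → O → O → Prop
  | true => r
  | false => fun o o' => r o' o

end SeqGame


namespace SeqGame

variable {A C O : Type*}

theorem pre_length (p : ℕ → C) (n : ℕ) : (pre p n).length = n := by simp [pre]

theorem pre_eq_iff {p q : ℕ → C} {n : ℕ} : pre p n = pre q n ↔ ∀ i < n, p i = q i := by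
  simp only [pre, List.ofFn_inj, funext_iff]
  exact ⟨fun h i hi => h ⟨i, hi⟩, fun h i => h i i.2⟩

theorem pre_eq_of_le {p q : ℕ → C} {m n : ℕ} (hmn : m ≤ n) (h : pre p n = pre q n) :
    pre p m = pre q m :=
  pre_eq_iff.2 fun i hi => pre_eq_iff.1 h i (hi.trans_le hmn)

theorem take_pre (p : ℕ → C) {m n : ℕ} (hmn : m ≤ n) : (pre p n).take m = pre p m := by
  apply List.ext_getElem
  · simp [pre, hmn]
  · intro i h₁ h₂
    simp [pre]

theorem pre_succ (p : ℕ → C) (n : ℕ) : pre p (n + 1) = pre p n ++ [p n] := by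
  simp only [pre, List.ofFn_succ_last, Fin.val_castSucc, Fin.val_last]

theorem hist_nil_eq_pre (σ : List C → C) (n : ℕ) : hist σ [] n = pre (play σ []) n := by
  induction n with
  | zero => simp [hist, pre]
  | succ n ih => rw [pre_succ, ← ih]; simp [hist, play]

theorem play_nil (σ : List C → C) (n : ℕ) : play σ [] n = σ (pre (play σ []) n) := by
  rw [← hist_nil_eq_pre]; simp [play]

theorem eq_play_nil {σ : List C → C} {p : ℕ → C} (h : ∀ n, p n = σ (pre p n)) :
    play σ [] = p := by
  funext n
  induction n using Nat.strong_induction_on with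
  | _ n ih => rw [play_nil, h, pre_eq_iff.2 ih]

/-- If the intersection of a terminal interval with a cone is determined, then from the root of
the cone either player `a` can force the outcome into the interval or the others can keep the
outcome out of it. -/
theorem force_or_avoid (d : List C → A) (v : (ℕ → C) → O) (a : A) (I : Set O) (γ : List C)
    (hdet : ∀ D : Set (List C), Determined D (v ⁻¹' I ∩ ext γ)) :
    (∃ s : List C → C, ∀ p, Consistent d a s γ p → v p ∈ I) ∨
    (∃ t : List C → C, ∀ p, pre p γ.length = γ →
      (∀ n, γ.length ≤ n → d (pre p n) ≠ a → p n = t (pre p n)) → v p ∉ I) := by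
  rcases hdet {h | d h = a ∨ h.length < γ.length} with ⟨s, hs⟩ | ⟨t, ht⟩
  · refine Or.inl ⟨s, fun q hq => (hs q fun n hn => ?_).1⟩
    simp only [Set.mem_ofPred_eq, pre_length] at hn
    rcases lt_or_ge n γ.length with hlt | hge
    · have hγ : pre (play s []) γ.length = γ := (hs (play s []) fun n _ => play_nil s n).2
      have hpq : pre q γ.length = pre (play s []) γ.length := hq.1.trans hγ.symm
      rw [pre_eq_of_le hlt.le hpq, ← play_nil s]
      exact pre_eq_iff.1 hpq n hlt
    · exact hq.2 n hge (hn.resolve_right (by omega))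
  · refine Or.inr ⟨t, fun q hq hqt hI => ht q (fun n hn => ?_) ⟨hI, hq⟩⟩
    simp only [Set.mem_ofPred_eq, pre_length, not_or, not_lt] at hn
    exact hqt n hn.2 hn.1

theorem Gua_subset_of_follows {d : List C → A} {v : (ℕ → C) → O} {r : O → O → Prop} {a : A}
    {s : List C → C} {p : ℕ → C} {k n : ℕ} (hkn : k ≤ n)
    (hs : gua d v r a (pre p k) s = Gua d v r a (pre p k))
    (hp : ∀ i, k ≤ i → i < n → d (pre p i) = a → p i = s (pre p i)) :
    Gua d v r a (pre p n) ⊆ Gua d v r a (pre p k) := by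
  rw [← hs]
  intro o ho
  obtain ⟨q, ⟨hq, hqs⟩, hoq⟩ := Set.mem_iInter.1 ho s
  rw [pre_length] at hq hqs
  refine ⟨q, ⟨by rw [pre_length]; exact pre_eq_of_le hkn hq, fun i hi hdi => ?_⟩, hoq⟩
  rw [pre_length] at hi
  rcases lt_or_ge i n with hlt | hge
  · rw [pre_eq_of_le hlt.le hq] at hdi ⊢
    rw [pre_eq_iff.1 hq i hlt]
    exact hp i hi hlt hdi
  · exact hqs i hge hdi

/-- There is a play whose outcome lies in the best guarantee of the owner of each of its
positions. -/
theorem exists_play_mem_Gua (d : List C → A) (v : (ℕ → C) → O) (prec : A → O → O → Prop)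
    (hirr : ∀ a x, ¬ prec a x x)
    (hlim : ∀ (a : A) (p : ℕ → C) (φ : ℕ → ℕ), StrictMono φ →
      (∀ n, d (pre p (φ n)) = a) →
      (∀ n, Gua d v (prec a) a (pre p (φ (n + 1))) ⊂ Gua d v (prec a) a (pre p (φ n))) →
      v p ∈ ⋂ n, Gua d v (prec a) a (pre p (φ n)))
    (hopt : ∀ (a : A) (γ : List C), ∃ s : List C → C,
      gua d v (prec a) a γ s = Gua d v (prec a) a γ) :
    ∃ p : ℕ → C, ∀ n, v p ∈ Gua d v (prec (d (pre p n))) (d (pre p n)) (pre p n) := by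
  classical
  choose S hS using hopt
  have hex : ∀ h : List C, ∃ k, d (h.take k) = d h ∧
      Gua d v (prec (d h)) (d h) (h.take k) = Gua d v (prec (d h)) (d h) h :=
    fun h => ⟨h.length, by simp⟩
  let σ : List C → C := fun h => S (d h) (h.take (Nat.find (hex h))) h
  let p := play σ []
  refine ⟨p, fun n => ?_⟩
  generalize ha : d (pre p n) = a
  let G : ℕ → Set O := fun n => Gua d v (prec a) a (pre p n)
  -- Along `p`, player `a` sticks to the strategy chosen when the current guarantee first occurred.
  have first : ∀ m, d (pre p m) = a → ∃ k ≤ m, d (pre p k) = a ∧ G k = G m ∧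
      ∀ i, k ≤ i → d (pre p i) = a → G i = G m →
        p i = S a (pre p k) (pre p i) := by
    intro m hm
    have hex' : ∃ k, d (pre p k) = a ∧ G k = G m := ⟨m, hm, rfl⟩
    obtain ⟨hk₁, hk₂⟩ := Nat.find_spec hex'
    refine ⟨Nat.find hex', Nat.find_min' hex' ⟨hm, rfl⟩, hk₁, hk₂, fun i hi hdi hGi => ?_⟩
    have hpi : p i = S a ((pre p i).take (Nat.find (hex (pre p i)))) (pre p i) := by
      rw [show p i = σ (pre p i) from play_nil σ i]
      simp only [σ, hdi]
    have hfind : Nat.find (hex (pre p i)) = Nat.find hex' := by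
      rw [Nat.find_eq_iff]
      constructor
      · rw [take_pre p hi, hdi]
        exact ⟨hk₁, hk₂.trans hGi.symm⟩
      · intro j hj hj'
        rw [take_pre p (hj.le.trans hi), hdi] at hj'
        exact Nat.find_min hex' hj ⟨hj'.1, hj'.2.trans hGi⟩
    rw [hpi, hfind, take_pre p hi]
  have anti : ∀ n, d (pre p n) = a → ∀ m ≤ n, d (pre p m) = a → G n ⊆ G m := by
    intro n
    induction n using Nat.strong_induction_on with
    | _ n ih =>
      intro hn m hmn hm
      rcases hmn.eq_or_lt with rfl | hlt
      · exact subset_rfl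
      let j := Nat.findGreatest (fun j => d (pre p j) = a) (n - 1)
      have hj : d (pre p j) = a :=
        Nat.findGreatest_spec (P := fun j => d (pre p j) = a) (m := m) (by omega) hm
      have hjn : j < n := by
        have : j ≤ n - 1 := Nat.findGreatest_le _
        omega
      have hle : ∀ i < n, d (pre p i) = a → i ≤ j := fun i hi hdi =>
        Nat.le_findGreatest (by omega) hdi
      obtain ⟨k, hkj, hk, hGk, hfol⟩ := first j hj
      refine Set.Subset.trans ?_ (ih j hjn hj m (hle m hlt hm) hm)
      rw [← hGk]
      refine Gua_subset_of_follows (hkj.trans hjn.le) (hS a _) fun i hi hin hdi => ?_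
      refine hfol i hi hdi (subset_antisymm ?_ (ih j hjn hj i (hle i hin hdi) hdi))
      rw [← hGk]
      exact ih i hin hdi k hi hk
  change v p ∈ G n
  by_cases hstab : ∃ m, n ≤ m ∧ d (pre p m) = a ∧ ∀ i, m ≤ i → d (pre p i) = a → G i = G m
  · obtain ⟨m, hnm, hm, hconst⟩ := hstab
    obtain ⟨k, hkm, hk, hGk, hfol⟩ := first m hm
    refine anti m hm n hnm ha ?_
    rw [← hGk]
    change v p ∈ Gua d v (prec a) a (pre p k)
    rw [← hS a (pre p k)]
    refine ⟨p, ⟨by rw [pre_length], fun i hi hdi => ?_⟩, hirr a _⟩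
    rw [pre_length] at hi
    refine hfol i hi hdi ?_
    rcases le_total m i with hmi | him
    · exact hconst i hmi hdi
    · refine subset_antisymm ?_ (anti m hm i him hdi)
      rw [← hGk]
      exact anti i hdi k hi hk
  · push Not at hstab
    have step : ∀ x : {m // n ≤ m ∧ d (pre p m) = a}, ∃ y : {m // n ≤ m ∧ d (pre p m) = a},
        x.1 < y.1 ∧ G y.1 ⊂ G x.1 := by
      rintro ⟨m, hnm, hm⟩
      obtain ⟨i, hmi, hdi, hne⟩ := hstab m hnm hm
      have hlt : m < i := lt_of_le_of_ne hmi fun h => hne (h ▸ rfl)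
      exact ⟨⟨i, hnm.trans hmi, hdi⟩, hlt, (anti i hdi m hmi hm).ssubset_of_ne hne⟩
    choose next hnext using step
    let f : ℕ → {m // n ≤ m ∧ d (pre p m) = a} := fun i => next^[i] ⟨n, le_rfl, ha⟩
    have hf : ∀ i, f (i + 1) = next (f i) := fun i => Function.iterate_succ_apply' _ _ _
    have := hlim a p (fun i => (f i).1)
      (strictMono_nat_of_lt_succ fun i => by rw [hf]; exact (hnext _).1)
      (fun i => (f i).2.2) (fun i => by rw [hf]; exact (hnext _).2)
    exact Set.mem_iInter.1 this 0

/-- If the outcome `o` lies in the best guarantee of player `a` at one of her positions, then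
moving elsewhere from that position does not allow her to force better outcomes than `o`. -/
theorem not_force_better {d : List C → A} {v : (ℕ → C) → O} {r : O → O → Prop} {a : A}
    {o : O} {q : ℕ → C} {n : ℕ} (hd : d (pre q n) = a)
    (ho : o ∈ Gua d v r a (pre q n)) (s : List C → C) :
    ¬ ∀ p, Consistent d a s (pre q (n + 1)) p → r o (v p) := by
  classical
  intro hs
  obtain ⟨p, ⟨hp, hps⟩, hop⟩ :=
    Set.mem_iInter.1 ho (fun h => if h = pre q n then q n else s h)
  rw [pre_length] at hp hps
  refine hop (hs p ⟨?_, fun i hi hdi => ?_⟩)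
  · rw [pre_length, pre_succ, pre_succ, hp, hps n le_rfl (hp ▸ hd)]
    simp only [hp, if_true]
  · rw [pre_length] at hi
    refine (hps i (by omega) hdi).trans (if_neg fun h => ?_)
    have := congrArg List.length h
    rw [pre_length, pre_length] at this
    omega

end SeqGame

open SeqGame in
/-- existence of Nash equilibria in multi-player multi-outcome infinite
sequential games, given determinacy of the win/lose games associated with the terminal
intervals of the preferences, and witnessed, well-behaved best guarantees. -/
theorem stmt12 {A C O : Type*} [Nonempty A] [Nonempty C] [Nonempty O]
    (d : List C → A) (v : (ℕ → C) → O) (prec : A → O → O → Prop)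
    (Γ : Set (Set (ℕ → C)))
    (h1 : ∀ a : A, SWO (prec a))
    (h2 : ∀ (D : Set (List C)) (W : Set (ℕ → C)), W ∈ Γ → Determined D W)
    (h3 : ∀ (a : A) (I : Set O), Terminal (prec a) I → ∀ γ : List C,
      (v ⁻¹' I ∩ ext γ) ∈ Γ)
    (h4 : ∀ (a : A) (p : ℕ → C) (φ : ℕ → ℕ), StrictMono φ →
      (∀ n, d (pre p (φ n)) = a) →
      (∀ n, Gua d v (prec a) a (pre p (φ (n + 1))) ⊂ Gua d v (prec a) a (pre p (φ n))) →
      v p ∈ ⋂ n, Gua d v (prec a) a (pre p (φ n)))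
    (h5 : ∀ (a : A) (γ : List C), ∃ s : List C → C,
      gua d v (prec a) a γ s = Gua d v (prec a) a γ) :
    ∃ σ : List C → C, ∀ (a : A) (σ' : List C → C), Dev d a σ σ' →
      ¬ prec a (v (play σ [])) (v (play σ' [])) := by
  classical
  obtain ⟨p, hp⟩ := exists_play_mem_Gua d v prec (fun a => (h1 a).1) h4 h5
  have hterm : ∀ a, Terminal (prec a) {x | prec a (v p) x} := by
    intro a x hx y hyx
    by_contra hy
    exact (h1 a).2.2 _ _ _ hy hyx hx
  have hpun : ∀ a γ, ∃ t : List C → C,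
      (∃ s : List C → C, ∀ q, Consistent d a s γ q → prec a (v p) (v q)) ∨
      (∀ q, pre q γ.length = γ →
        (∀ n, γ.length ≤ n → d (pre q n) ≠ a → q n = t (pre q n)) → ¬ prec a (v p) (v q)) := by
    intro a γ
    rcases force_or_avoid d v a {x | prec a (v p) x} γ
      (fun D => h2 D _ (h3 a _ (hterm a) γ)) with hs | ⟨t, ht⟩
    · exact ⟨fun _ => Classical.arbitrary C, Or.inl hs⟩
    · exact ⟨t, Or.inr ht⟩
  choose T hT using hpun
  let σ : List C → C := fun h =>
    if hn : ∃ n, n < h.length ∧ h.take (n + 1) ≠ pre p (n + 1) then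
      T (d (pre p (Nat.find hn))) (h.take (Nat.find hn + 1)) h
    else p h.length
  have hσp : play σ [] = p := by
    refine eq_play_nil fun n => ?_
    have hn : ¬ ∃ m, m < (pre p n).length ∧ (pre p n).take (m + 1) ≠ pre p (m + 1) := by
      rintro ⟨m, hm, hne⟩
      rw [pre_length] at hm
      exact hne (take_pre p hm)
    simp only [σ, dif_neg hn, pre_length]
  refine ⟨σ, fun a σ' hdev => ?_⟩
  rw [hσp]
  set q := play σ' [] with hq
  by_cases hqp : ∃ n, q n ≠ p n
  · let n := Nat.find hqp
    have hne : q n ≠ p n := Nat.find_spec hqp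
    have heq : pre q n = pre p n := pre_eq_iff.2 fun i hi => not_not.1 (Nat.find_min hqp hi)
    have hda : d (pre q n) = a := by
      by_contra hda
      apply hne
      rw [hq, play_nil, ← hq, hdev _ hda, heq, ← hσp, ← play_nil σ]
    have hoff : ∀ m, n + 1 ≤ m → σ (pre q m) = T a (pre q (n + 1)) (pre q m) := by
      intro m hm
      have hex : ∃ i, i < (pre q m).length ∧ (pre q m).take (i + 1) ≠ pre p (i + 1) := by
        refine ⟨n, by rw [pre_length]; omega, ?_⟩
        rw [take_pre q hm]
        exact fun h => hne (pre_eq_iff.1 h n (by omega))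
      have hfind : Nat.find hex = n := by
        rw [Nat.find_eq_iff]
        refine ⟨⟨by rw [pre_length]; omega, ?_⟩, ?_⟩
        · rw [take_pre q hm]
          exact fun h => hne (pre_eq_iff.1 h n (by omega))
        · rintro i hi ⟨-, hi'⟩
          rw [take_pre q (by omega)] at hi'
          exact hi' (pre_eq_of_le hi heq)
      simp only [σ, dif_pos hex, hfind, take_pre q hm, ← heq, hda]
    rcases hT a (pre q (n + 1)) with ⟨s, hs⟩ | ht
    · have hmem := hp n
      rw [← heq, hda] at hmem
      exact absurd hs (not_force_better hda hmem s)
    · refine ht q (by rw [pre_length]) fun m hm hdm => ?_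
      rw [pre_length] at hm
      rw [← hoff m hm, ← hdev _ hdm, hq, ← play_nil σ']
  · push Not at hqp
    rw [funext hqp]
    exact (h1 a).1 _
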